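/- Let d ≥ 1 and p ≥ 0 be integers. In the group algebra ℚ[S_d], the element Z_p := Σ τ_p·τ_{p−1}⋯τ₁, where the sum runs over all tuples (τ₁,…,τ_p) of transpositions in S_d with top(τ₁) ≤ top(τ₂) ≤ … ≤ top(τ_p), lies in the center of ℚ[S_d], i.e. Z_p commutes with every element of ℚ[S_d]. (Equivalently, Z_p equals the complete homogeneous symmetric polynomial h_p evaluated at the Jucys–Murphy elements J₂,…,J_d, where J_i = Σ_{j<i} (j i), and symmetric polynomials in the Jucys–Murphy elements are central.) -/

import Mathlib

/-- The larger moved point of a transposition (as a natural number):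
the supremum of the values in its support. -/
def permTop {d : ℕ} (τ : Equiv.Perm (Fin d)) : ℕ := τ.support.sup Fin.val

open scoped Classical in
/-- The element `Z_p = Σ τ_p·τ_{p−1}⋯τ₁` of the group algebra `ℚ[S_d]`, where the sum
runs over all tuples `(τ₁,…,τ_p)` of transpositions with
`top τ₁ ≤ top τ₂ ≤ … ≤ top τ_p`. -/
noncomputable def weaklyMonotoneSum (d p : ℕ) :
    MonoidAlgebra ℚ (Equiv.Perm (Fin d)) :=
  ∑ τ : Fin p → Equiv.Perm (Fin d),
    if (∀ i, (τ i).IsSwap) ∧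
        (∀ i j : Fin p, (j : ℕ) = (i : ℕ) + 1 → permTop (τ i) ≤ permTop (τ j))
    then MonoidAlgebra.single ((List.ofFn τ).reverse.prod) (1 : ℚ) else 0

open Equiv in
noncomputable def JM {d : ℕ} (k : Fin d) : MonoidAlgebra ℚ (Perm (Fin d)) :=
  ∑ j ∈ Finset.univ.filter (fun j => j < k), MonoidAlgebra.single (swap j k) (1 : ℚ)

noncomputable def HH (d : ℕ) : ℕ → ℕ → MonoidAlgebra ℚ (Equiv.Perm (Fin d))
  | 0, _ => 1
  | p + 1, m => ∑ k ∈ Finset.univ.filter (fun k : Fin d => (k : ℕ) < m), JM k * HH d p (k + 1)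

theorem HH_succ {d : ℕ} (p : ℕ) (m : Fin d) :
    HH d (p + 1) (m + 1) = JM m * HH d p (m + 1) + HH d (p + 1) m := by
  have : Finset.univ.filter (fun k : Fin d => (k : ℕ) < m + 1)
      = insert m (Finset.univ.filter (fun k : Fin d => (k : ℕ) < m)) := by
    ext k; simp [Fin.ext_iff]; omega
  rw [HH, this, Finset.sum_insert (by simp), HH]

theorem HH_zero {d : ℕ} (p : ℕ) : HH d (p + 1) 0 = 0 := by
  simp [HH]

open Equiv in
theorem JM_conj {d : ℕ} (g : Perm (Fin d)) (k : Fin d) (hk : g k = k)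
    (hg : ∀ j, g j < k ↔ j < k) :
    Commute (MonoidAlgebra.single g (1 : ℚ)) (JM k) := by
  unfold JM Commute SemiconjBy
  rw [Finset.mul_sum, Finset.sum_mul]
  refine Finset.sum_bij (fun j _ => g j) ?_ ?_ ?_ ?_
  · intro j hj; simpa [hg] using hj
  · intro a _ b _ h; exact g.injective h
  · intro b hb
    refine ⟨g⁻¹ b, ?_, by simp⟩
    have := hg (g⁻¹ b)
    simp at this hb ⊢
    exact this.1 hb
  · intro j hj
    rw [MonoidAlgebra.single_mul_single, MonoidAlgebra.single_mul_single]
    congr 1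
    conv_rhs => rw [← hk]
    rw [Equiv.swap_apply_apply]; simp

theorem JM_comm {d : ℕ} (i k : Fin d) (h : i < k) : Commute (JM i) (JM k) := by
  rw [JM]
  refine Commute.sum_left _ _ _ fun j hj => ?_
  simp at hj
  refine JM_conj _ _ (Equiv.swap_apply_of_ne_of_ne (by omega) (by omega)) ?_
  intro l
  rw [Equiv.swap_apply_def]
  split_ifs <;> omega

open Equiv in
theorem JM_rel {d : ℕ} (i k : Fin d) (h : (k : ℕ) = i + 1) :
    JM k * MonoidAlgebra.single (swap i k) (1 : ℚ)
      = MonoidAlgebra.single (swap i k) (1 : ℚ) * JM i + 1 := by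
  have hs : Finset.univ.filter (fun j => j < k)
      = insert i (Finset.univ.filter (fun j => j < i)) := by
    ext j; simp [Fin.ext_iff]; omega
  rw [JM, hs, Finset.sum_insert (by simp), add_mul, add_comm]
  congr 1
  · rw [JM, Finset.mul_sum, Finset.sum_mul]
    refine Finset.sum_congr rfl fun j hj => ?_
    simp at hj
    rw [MonoidAlgebra.single_mul_single, MonoidAlgebra.single_mul_single]
    congr 1
    have h1 : swap i k j = j := swap_apply_of_ne_of_ne (by omega) (by omega)
    have := Equiv.swap_apply_apply (swap i k) j i
    rw [h1, swap_apply_left] at this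
    rw [this]; simp
  · rw [MonoidAlgebra.single_mul_single]; simp [MonoidAlgebra.one_def]

theorem two_var {R : Type*} [Ring R] (s a b : R) (A B C : ℕ → R)
    (hA : ∀ p, Commute s (A p)) (hab : a * b = b * a) (hs : s * s = 1)
    (hr : b * s = s * a + 1) (B0 : B 0 = 1) (C0 : C 0 = 1)
    (hB : ∀ p, B (p + 1) = a * B p + A (p + 1))
    (hC : ∀ p, C (p + 1) = b * C p + B (p + 1)) : ∀ p, Commute s (C p) := by
  have hr2 : s * b = a * s + 1 := by
    have : s * (b * s) * s = s * (s * a + 1) * s := by rw [hr]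
    calc s * b = s * (b * s) * s := by simp [mul_assoc, hs]
      _ = (s * s) * a * s + s * s := by rw [this]; noncomm_ring
      _ = _ := by simp [hs]
  have h1 : Commute s (a + b) := by
    unfold Commute SemiconjBy
    rw [mul_add, add_mul, hr, hr2]; abel
  have h2 : Commute s (a * b) := by
    unfold Commute SemiconjBy
    have : s * a = b * s - 1 := by rw [hr]; simp
    rw [← mul_assoc, this, sub_mul, mul_assoc, hr2, hab]; noncomm_ring
  have rec2 : ∀ p, C (p + 2) = (a + b) * C (p + 1) - (a * b) * C p + A (p + 2) := by
    intro p
    have e : B (p + 1) = C (p + 1) - b * C p := by rw [hC]; abel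
    rw [hC (p + 1), hB (p + 1), e]; noncomm_ring
  have key : ∀ p, Commute s (C p) ∧ Commute s (C (p + 1)) := by
    intro p
    induction p with
    | zero =>
      refine ⟨by rw [C0]; exact Commute.one_right _, ?_⟩
      have : C (0 + 1) = (a + b) + A 1 := by rw [hC, hB, B0, C0]; simp; abel
      rw [this]; exact h1.add_right (hA _)
    | succ p ih =>
      refine ⟨ih.2, ?_⟩
      rw [rec2]
      exact ((h1.mul_right ih.2).sub_right (h2.mul_right ih.1)).add_right (hA _)
  exact fun p => (key p).1

open Equiv in
theorem HH_comm {d : ℕ} (i k : Fin d) (h : (k : ℕ) = i + 1) (m : ℕ) (hm : m ≤ d)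
    (hmk : m ≠ k) : ∀ p, Commute (MonoidAlgebra.single (swap i k) (1 : ℚ)) (HH d p m) := by
  have hJ : ∀ l : Fin d, l ≠ i → l ≠ k →
      Commute (MonoidAlgebra.single (swap i k) (1 : ℚ)) (JM l) := by
    intro l h1 h2
    refine JM_conj _ _ (swap_apply_of_ne_of_ne h1 h2) ?_
    intro j
    rw [swap_apply_def]
    split_ifs <;> omega
  have step : ∀ m : Fin d, m ≠ i → m ≠ k →
      (∀ p, Commute (MonoidAlgebra.single (swap i k) (1 : ℚ)) (HH d p m)) →
      ∀ p, Commute (MonoidAlgebra.single (swap i k) (1 : ℚ)) (HH d p (m + 1)) := by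
    intro m h1 h2 hh p
    induction p with
    | zero => exact Commute.one_right _
    | succ p ih =>
      rw [HH_succ]
      exact ((hJ m h1 h2).mul_right ih).add_right (hh _)
  have low : ∀ m : ℕ, m ≤ i →
      ∀ p, Commute (MonoidAlgebra.single (swap i k) (1 : ℚ)) (HH d p m) := by
    intro m
    induction m with
    | zero =>
      intro _ p
      cases p with
      | zero => exact Commute.one_right _
      | succ p => rw [HH_zero]; exact Commute.zero_right _
    | succ m ih =>
      intro hm
      exact step ⟨m, by omega⟩ (by simp [Fin.ext_iff]; omega) (by simp [Fin.ext_iff]; omega)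
        (ih (by omega))
  have high : ∀ m : ℕ, (k : ℕ) + 1 ≤ m → m ≤ d →
      ∀ p, Commute (MonoidAlgebra.single (swap i k) (1 : ℚ)) (HH d p m) := by
    intro m hkm
    induction m, hkm using Nat.le_induction with
    | base =>
      intro _
      refine two_var _ (JM i) (JM k) (fun p => HH d p i) (fun p => HH d p (i + 1))
        (fun p => HH d p (k + 1)) (low i le_rfl) (JM_comm i k (by omega)).eq ?_
        (JM_rel i k h) rfl rfl (fun p => HH_succ p i) ?_
      · rw [MonoidAlgebra.single_mul_single]; simp [MonoidAlgebra.one_def]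
      · intro p
        rw [← h]; exact HH_succ p k
    | succ m hm ih =>
      intro hd
      exact step ⟨m, by omega⟩ (by simp [Fin.ext_iff]; omega) (by simp [Fin.ext_iff]; omega)
        (ih (by omega))
  by_cases hc : m ≤ i
  · exact low m hc
  · exact high m (by omega) hm

open Equiv in
theorem permTop_swap {d : ℕ} (j k : Fin d) (h : j < k) : permTop (swap j k) = k := by
  unfold permTop
  rw [Perm.support_swap h.ne]
  simp [Finset.sup_insert]
  omega

open scoped Classical in
theorem sum_swap {d : ℕ} {M : Type*} [AddCommMonoid M] (m : ℕ)
    (f : Equiv.Perm (Fin d) → M) :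
    (∑ t : Equiv.Perm (Fin d), if t.IsSwap ∧ permTop t < m then f t else 0)
      = ∑ k ∈ Finset.univ.filter (fun k : Fin d => (k : ℕ) < m),
          ∑ j ∈ Finset.univ.filter (fun j => j < k), f (Equiv.swap j k) := by
  rw [← Finset.sum_filter, Finset.sum_sigma']
  symm
  refine Finset.sum_bij (fun x _ => Equiv.swap x.2 x.1) ?_ ?_ ?_ ?_
  · rintro ⟨k, j⟩ hx
    simp at hx ⊢
    exact ⟨⟨j, k, hx.2.ne, rfl⟩, by rw [permTop_swap _ _ hx.2]; exact hx.1⟩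
  · rintro ⟨k, j⟩ hx ⟨k', j'⟩ hx' he
    simp at hx hx' he
    have e : k = k' := by
      have := congrArg permTop he
      rw [permTop_swap _ _ hx.2, permTop_swap _ _ hx'.2] at this
      exact Fin.ext this
    subst e
    have := congrArg (fun g => g k) he
    simp at this
    simp [this]
  · intro t ht
    simp at ht
    obtain ⟨⟨x, y, hxy, rfl⟩, h2⟩ := ht
    rcases lt_or_gt_of_ne hxy with h | h
    · rw [permTop_swap _ _ h] at h2
      exact ⟨⟨y, x⟩, by simp [h, h2], rfl⟩
    · rw [Equiv.swap_comm, permTop_swap _ _ h] at h2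
      exact ⟨⟨x, y⟩, by simp [h, h2], Equiv.swap_comm _ _⟩
  · intros; rfl

def MonoT {d : ℕ} (p m : ℕ) (τ : Fin p → Equiv.Perm (Fin d)) : Prop :=
  ((∀ i, (τ i).IsSwap) ∧
    (∀ i j : Fin p, (j : ℕ) = (i : ℕ) + 1 → permTop (τ i) ≤ permTop (τ j))) ∧
    ∀ i : Fin p, (i : ℕ) + 1 = p → permTop (τ i) < m

theorem MonoT_snoc {d : ℕ} (p m : ℕ) (t : Equiv.Perm (Fin d))
    (τ : Fin p → Equiv.Perm (Fin d)) :
    MonoT (p + 1) m (Fin.snoc (α := fun _ => Equiv.Perm (Fin d)) τ t) ↔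
      (t.IsSwap ∧ permTop t < m) ∧ MonoT p (permTop t + 1) τ := by
  unfold MonoT
  simp only [Fin.forall_fin_succ', Fin.snoc_castSucc, Fin.snoc_last, Fin.val_castSucc,
    Fin.val_last, Nat.lt_succ_iff]
  constructor
  · rintro ⟨⟨⟨h1, h2⟩, h3, h4⟩, h5, h6⟩
    exact ⟨⟨h2, h6 trivial⟩, ⟨h1, fun i j => (h3 i).1 j⟩, fun i hi => (h3 i).2 hi.symm⟩
  · rintro ⟨⟨h2, h6⟩, ⟨h1, h3⟩, h4⟩
    exact ⟨⟨⟨h1, h2⟩, fun i => ⟨h3 i, fun h => h4 i h.symm⟩, fun i hi => by omega, by omega⟩,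
      fun i hi => by omega, fun _ => h6⟩

open scoped Classical in
theorem sum_eq_HH (d p : ℕ) : ∀ m : ℕ,
    (∑ τ : Fin p → Equiv.Perm (Fin d), if MonoT p m τ
      then MonoidAlgebra.single ((List.ofFn τ).reverse.prod) (1 : ℚ) else 0) = HH d p m := by
  induction p with
  | zero => intro m; simp [MonoT, HH, MonoidAlgebra.one_def]
  | succ p ih =>
    intro m
    rw [← (Fin.snocEquiv (fun _ : Fin (p + 1) => Equiv.Perm (Fin d))).sum_comp,
      Fintype.sum_prod_type]
    have : ∀ t : Equiv.Perm (Fin d), (∑ τ : Fin p → Equiv.Perm (Fin d),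
        if MonoT (p + 1) m (Fin.snocEquiv (fun _ : Fin (p + 1) => Equiv.Perm (Fin d)) (t, τ)) then
          MonoidAlgebra.single ((List.ofFn (Fin.snocEquiv
            (fun _ : Fin (p + 1) => Equiv.Perm (Fin d)) (t, τ))).reverse.prod) (1 : ℚ) else 0)
        = if t.IsSwap ∧ permTop t < m then
          MonoidAlgebra.single t (1 : ℚ) * HH d p (permTop t + 1) else 0 := by
      intro t
      rw [← ih]
      have e : ∀ τ : Fin p → Equiv.Perm (Fin d),
          Fin.snocEquiv (fun _ : Fin (p + 1) => Equiv.Perm (Fin d)) (t, τ)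
            = Fin.snoc (α := fun _ => Equiv.Perm (Fin d)) τ t := fun _ => rfl
      simp only [e, MonoT_snoc]
      by_cases h : t.IsSwap ∧ permTop t < m
      · simp only [h, true_and, and_self, if_true, Finset.mul_sum]
        refine Finset.sum_congr rfl fun τ _ => ?_
        rw [mul_ite, mul_zero, MonoidAlgebra.single_mul_single, List.ofFn_succ']
        simp
      · simp only [h, false_and, if_false, Finset.sum_const_zero]
    rw [Finset.sum_congr rfl fun t _ => this t, sum_swap, HH]
    refine Finset.sum_congr rfl fun k _ => ?_
    rw [JM, Finset.sum_mul]
    refine Finset.sum_congr rfl fun j hj => ?_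
    rw [permTop_swap _ _ (by simpa using hj)]

theorem wms_eq (d p : ℕ) (hd : 1 ≤ d) : weaklyMonotoneSum d p = HH d p d := by
  classical
  rw [← sum_eq_HH, weaklyMonotoneSum]
  refine Finset.sum_congr rfl fun τ _ => ?_
  have : ∀ t : Equiv.Perm (Fin d), permTop t < d := by
    intro t
    unfold permTop
    rw [Finset.sup_lt_iff (by simpa using Nat.lt_of_lt_of_le Nat.zero_lt_one hd)]
    intro b _; exact b.2
  have e : MonoT p d τ ↔ ((∀ i, (τ i).IsSwap) ∧
        (∀ i j : Fin p, (j : ℕ) = (i : ℕ) + 1 → permTop (τ i) ≤ permTop (τ j))) :=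
    ⟨fun h => h.1, fun h => ⟨h, fun i _ => this _⟩⟩
  by_cases h : MonoT p d τ
  · rw [if_pos h, if_pos (e.1 h)]
  · rw [if_neg h, if_neg (fun h' => h (e.2 h'))]

/-- `Z_p` lies in the center of the group algebra `ℚ[S_d]`: it commutes with every
element of `ℚ[S_d]`. -/
theorem weaklyMonotoneSum_central (d p : ℕ) (hd : 1 ≤ d)
    (x : MonoidAlgebra ℚ (Equiv.Perm (Fin d))) :
    weaklyMonotoneSum d p * x = x * weaklyMonotoneSum d p := by
  rw [wms_eq d p hd]
  obtain ⟨n, rfl⟩ : ∃ n, d = n + 1 := ⟨d - 1, by omega⟩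
  have key : ∀ g : Equiv.Perm (Fin (n + 1)),
      Commute (MonoidAlgebra.single g (1 : ℚ)) (HH (n + 1) p (n + 1)) := by
    intro g
    have hg : g ∈ Submonoid.closure
        (Set.range fun i : Fin n => Equiv.swap i.castSucc i.succ) := by
      rw [Equiv.Perm.mclosure_swap_castSucc_succ]; trivial
    induction hg using Submonoid.closure_induction with
    | mem x hx =>
      obtain ⟨i, rfl⟩ := hx
      exact HH_comm _ _ (by simp) _ le_rfl (by simp; omega) p
    | one => exact Commute.one_left _
    | mul a b _ _ ha hb =>
      have : MonoidAlgebra.single (a * b) (1 : ℚ)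
          = MonoidAlgebra.single a 1 * MonoidAlgebra.single b 1 := by
        rw [MonoidAlgebra.single_mul_single]; simp
      rw [this]; exact ha.mul_left hb
  have : Commute x (HH (n + 1) p (n + 1)) := by
    induction x using MonoidAlgebra.induction_on with
    | of g => exact key g
    | add a b ha hb => exact ha.add_left hb
    | smul r a ha => exact ha.smul_left r
  exact this.eq.symm
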